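/- arXiv:1605.09646 — 7 statements merged into one kernel-verified Lean document; each statement's English description precedes it below -/
import Mathlib

section
/- For every p ≥ 1 and k ∈ {1,…,p} there exists a finite set N of unit vectors in ℝ^p, each with at most k nonzero entries, with cardinality at most C(p,k)·9^k (C(p,k) the binomial coefficient), such that for every symmetric matrix A ∈ ℝ^{p×p}: sup over all unit vectors u ∈ ℝ^p with at most k nonzero entries of |uᵀAu| is at most 2·max_{u ∈ N} |uᵀAu|. -/
open Finset Matrix

theorem exists_finset_sphere_net (E : Type*) [NormedAddCommGroup E] [NormedSpace ℝ E]
    [FiniteDimensional ℝ E] :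
    ∃ N : Finset E, (∀ v ∈ N, ‖v‖ = 1) ∧ N.card ≤ 5 ^ Module.finrank ℝ E ∧
      ∀ u : E, ‖u‖ = 1 → ∃ v ∈ N, ‖u - v‖ < 1 / 2 := by
  classical
  let Sep : Finset E → Prop := fun s =>
    (∀ v ∈ s, ‖v‖ = 1) ∧ ∀ c ∈ s, ∀ d ∈ s, c ≠ d → 1 / 2 ≤ ‖c - d‖
  have card_le : ∀ s, Sep s → s.card ≤ 5 ^ Module.finrank ℝ E := by
    intro s hs
    have hinj : Function.Injective fun x : E => (2 : ℝ) • x := smul_right_injective E two_ne_zero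
    rw [← card_image_of_injective s hinj]
    apply Besicovitch.card_le_of_separated
    · simp only [mem_image]
      rintro _ ⟨x, hx, rfl⟩
      simp [norm_smul, hs.1 x hx]
    · simp only [mem_image]
      rintro _ ⟨x, hx, rfl⟩ _ ⟨y, hy, rfl⟩ hxy
      have := hs.2 x hx y hy fun h => hxy (by rw [h])
      rw [← smul_sub, norm_smul, Real.norm_two]
      linarith
  let S : Set ℕ := {n | ∃ s, Sep s ∧ s.card = n}
  have hbdd : BddAbove S := ⟨_, by rintro _ ⟨s, hs, rfl⟩; exact card_le s hs⟩
  obtain ⟨N, hN, hcard⟩ := Nat.sSup_mem (s := S) ⟨0, ∅, by simp [Sep], rfl⟩ hbdd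
  refine ⟨N, hN.1, card_le N hN, fun u hu => ?_⟩
  by_contra! hfar
  have huN : u ∉ N := fun h => by
    have := hfar u h
    norm_num at this
  have hins : Sep (insert u N) := by
    refine ⟨by simpa [hu] using hN.1, ?_⟩
    intro c hc d hd hcd
    rcases mem_insert.1 hc with rfl | hcN <;> rcases mem_insert.1 hd with rfl | hdN
    · exact absurd rfl hcd
    · exact hfar d hdN
    · rw [norm_sub_rev]; exact hfar c hcN
    · exact hN.2 c hcN d hdN hcd
  have := le_csSup hbdd ⟨_, hins, rfl⟩
  rw [card_insert_of_notMem huN] at this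
  omega

section QuadraticForm

variable {E : Type*} [NormedAddCommGroup E] [InnerProductSpace ℝ E]

theorem half_le_apply_of_norm_sub_le (B : E →ₗ[ℝ] E →ₗ[ℝ] ℝ) (hB : ∀ x y, B x y = B y x)
    {u v : E} (hu : ‖u‖ = 1) (hv : ‖v‖ = 1) (huv : ‖u - v‖ ≤ 1 / 2)
    (hmax : ∀ x, |B x x| ≤ B u u * ‖x‖ ^ 2) : B u u ≤ 2 * B v v := by
  set c := inner ℝ u v with hc
  have hc_ge : 7 / 8 ≤ c := by
    have h := norm_sub_sq_real u v
    rw [hu, hv] at h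
    nlinarith [norm_nonneg (u - v)]
  have hnorm (r s : ℝ) : ‖r • v - s • u‖ ^ 2 = r ^ 2 - 2 * (r * s * c) + s ^ 2 := by
    rw [norm_sub_sq_real, norm_smul, norm_smul, hu, hv, inner_smul_left, inner_smul_right,
      real_inner_comm]
    simp only [mul_one, Real.norm_eq_abs, sq_abs, conj_trivial, ← hc]
    ring
  have hform (r s : ℝ) :
      B (r • v - s • u) (r • v - s • u) = r ^ 2 * B v v - 2 * (r * s * B u v) + s ^ 2 * B u u := by
    simp only [map_sub, map_smul, LinearMap.sub_apply, LinearMap.smul_apply, smul_eq_mul, hB v u]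
    ring
  have hpos : 0 ≤ B u u := by simpa [hu] using (abs_nonneg _).trans (hmax u)
  have h₁ := (abs_le.1 (hmax ((1 : ℝ) • v - c • u))).1
  have h₂ := (abs_le.1 (hmax ((1 / 15 : ℝ) • v - (16 / 15 * c) • u))).2
  rw [hnorm, hform] at h₁ h₂
  have hc_sq : 49 / 64 ≤ c ^ 2 := by nlinarith
  nlinarith [mul_le_mul_of_nonneg_left hc_sq hpos]

theorem exists_mem_abs_apply_le_two_mul [FiniteDimensional ℝ E] (B : E →ₗ[ℝ] E →ₗ[ℝ] ℝ)
    (hB : ∀ x y, B x y = B y x) {N : Finset E} (hN : ∀ v ∈ N, ‖v‖ = 1)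
    (hnet : ∀ u : E, ‖u‖ = 1 → ∃ v ∈ N, ‖u - v‖ < 1 / 2) {u : E} (hu : ‖u‖ = 1) :
    ∃ v ∈ N, |B u u| ≤ 2 * |B v v| := by
  have hcont : Continuous fun x : E => |B x x| := by
    have : Continuous fun x : E => B.toContinuousBilinearMap x x := by fun_prop
    exact this.abs
  obtain ⟨w, hw, hwmax⟩ := (isCompact_sphere (0 : E) 1).exists_isMaxOn ⟨u, by simpa using hu⟩
    hcont.continuousOn
  replace hw : ‖w‖ = 1 := by simpa using hw
  have hsphere : ∀ x : E, ‖x‖ = 1 → |B x x| ≤ |B w w| := fun x hx => hwmax (by simpa using hx)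
  have hmax : ∀ x, |B x x| ≤ |B w w| * ‖x‖ ^ 2 := by
    intro x
    rcases eq_or_ne x 0 with rfl | hx
    · simp
    · have hx' : 0 < ‖x‖ := norm_pos_iff.2 hx
      have h := hsphere (‖x‖⁻¹ • x) (norm_smul_inv_norm hx)
      simp only [map_smul, LinearMap.smul_apply, smul_eq_mul, abs_mul, abs_inv, abs_norm] at h
      field_simp at h
      rwa [mul_comm] at h
  obtain ⟨v, hv, hwv⟩ := hnet w hw
  refine ⟨v, hv, (hsphere u hu).trans ?_⟩
  rcases abs_cases (B w w) with ⟨h, -⟩ | ⟨h, -⟩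
  · have := half_le_apply_of_norm_sub_le B hB hw (hN v hv) hwv.le fun x => h ▸ hmax x
    linarith [le_abs_self (B v v)]
  · have := half_le_apply_of_norm_sub_le (-B) (by simp [hB]) hw (hN v hv) hwv.le
      (by simpa [← h] using hmax)
    simp only [LinearMap.neg_apply] at this
    linarith [neg_abs_le (B v v)]

end QuadraticForm

/-- Extension by zero of a vector indexed by `J`. -/
noncomputable def extendByZero {ι : Type*} (J : Finset ι) : EuclideanSpace ℝ J →ₗ[ℝ] ι → ℝ :=
  Function.ExtendByZero.linearMap ℝ ((↑) : J → ι) ∘ₗ (WithLp.linearEquiv 2 ℝ (J → ℝ)).toLinearMap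

section ExtendByZero

variable {ι : Type*} (J : Finset ι)

theorem extendByZero_coe (x : EuclideanSpace ℝ J) (j : J) : extendByZero J x j = x j :=
  Subtype.val_injective.extend_apply _ _ j

theorem extendByZero_of_notMem (x : EuclideanSpace ℝ J) {i : ι} (hi : i ∉ J) :
    extendByZero J x i = 0 :=
  Function.extend_apply' _ _ _ (by rintro ⟨j, rfl⟩; exact hi j.2)

theorem sum_extendByZero_sq [Fintype ι] (x : EuclideanSpace ℝ J) :
    ∑ i, extendByZero J x i ^ 2 = ‖x‖ ^ 2 := by
  rw [EuclideanSpace.real_norm_sq_eq,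
    ← sum_subset J.subset_univ fun i _ hi => by simp [extendByZero_of_notMem J x hi],
    ← sum_coe_sort J]
  simp only [extendByZero_coe]

theorem exists_extendByZero_eq {u : ι → ℝ} (hu : ∀ i, u i ≠ 0 → i ∈ J) :
    ∃ x, extendByZero J x = u := by
  refine ⟨WithLp.toLp 2 fun j => u j, funext fun i => ?_⟩
  by_cases hi : i ∈ J
  · exact extendByZero_coe J _ ⟨i, hi⟩
  · rw [extendByZero_of_notMem J _ hi, not_imp_comm.1 (hu i) hi]

end ExtendByZero

theorem stmt_1 (p k : ℕ) (hp : 1 ≤ p) (hk : 1 ≤ k) (hkp : k ≤ p) :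
    ∃ N : Finset (Fin p → ℝ),
      (∀ v ∈ N, (∑ i, v i ^ 2) = 1 ∧
        (Finset.univ.filter fun i => v i ≠ 0).card ≤ k) ∧
      N.card ≤ p.choose k * 9 ^ k ∧
      ∀ A : Matrix (Fin p) (Fin p) ℝ, A.IsSymm →
        ∀ u : Fin p → ℝ, (∑ i, u i ^ 2) = 1 →
          (Finset.univ.filter fun i => u i ≠ 0).card ≤ k →
          ∃ v ∈ N, abs (u ⬝ᵥ A.mulVec u) ≤ 2 * abs (v ⬝ᵥ A.mulVec v) := by
  classical
  choose net hnorm hcard hnet using fun J : Finset (Fin p) =>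
    exists_finset_sphere_net (EuclideanSpace ℝ J)
  refine ⟨(powersetCard k univ).biUnion fun J => (net J).image (extendByZero J), ?_, ?_, ?_⟩
  · simp only [mem_biUnion, mem_image, mem_powersetCard]
    rintro _ ⟨J, ⟨-, hJ⟩, x, hx, rfl⟩
    refine ⟨by rw [sum_extendByZero_sq, hnorm J x hx, one_pow], ?_⟩
    rw [← hJ]
    refine card_le_card fun i hi => ?_
    by_contra hiJ
    exact (mem_filter.1 hi).2 (extendByZero_of_notMem J x hiJ)
  · refine (card_biUnion_le_card_mul _ _ (9 ^ k) fun J hJ => ?_).trans_eq (by simp)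
    refine card_image_le.trans ((hcard J).trans ?_)
    rw [finrank_euclideanSpace, Fintype.card_coe, (mem_powersetCard.1 hJ).2]
    gcongr
    norm_num
  · intro A hA u hu hsupp
    obtain ⟨J, hJ, hJcard⟩ := exists_superset_card_eq hsupp (by simpa using hkp)
    obtain ⟨x, rfl⟩ := exists_extendByZero_eq J (u := u) fun i hi => hJ (by simpa using hi)
    have hx : ‖x‖ = 1 := by
      rw [sum_extendByZero_sq] at hu
      exact (pow_eq_one_iff_of_nonneg (norm_nonneg x) two_ne_zero).1 hu
    obtain ⟨v, hv, hle⟩ := exists_mem_abs_apply_le_two_mul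
      ((Matrix.toLinearMap₂' ℝ A).compl₁₂ (extendByZero J) (extendByZero J))
      (fun y z => by
        simp only [LinearMap.compl₁₂_apply, Matrix.toLinearMap₂'_apply']
        rw [dotProduct_mulVec, ← mulVec_transpose, hA.eq, dotProduct_comm])
      (hnorm J) (hnet J) hx
    refine ⟨extendByZero J v, mem_biUnion.2 ⟨J, by simp [mem_powersetCard, hJcard],
      mem_image_of_mem _ hv⟩, ?_⟩
    simpa only [LinearMap.compl₁₂_apply, Matrix.toLinearMap₂'_apply'] using hle
end

section
/- Let X ∈ ℝ^{n×p}, k ∈ {1,…,p} and θ ∈ (0,1]. If every entry of the matrix XᵀX − I_p has absolute value at most θ/k, then X satisfies RIP(k,θ). -/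
open Finset Matrix

/-- `X ∈ RIP(k,θ)`: `1-θ ≤ ‖Xu‖₂² ≤ 1+θ` for every unit vector `u` with at most `k`
nonzero entries. -/
def RIP (n p : ℕ) (k : ℕ) (θ : ℝ) (X : Matrix (Fin n) (Fin p) ℝ) : Prop :=
  ∀ u : Fin p → ℝ, (∑ i, u i ^ 2) = 1 →
    (Finset.univ.filter fun i => u i ≠ 0).card ≤ k →
    1 - θ ≤ ∑ i, (X.mulVec u i) ^ 2 ∧ ∑ i, (X.mulVec u i) ^ 2 ≤ 1 + θ

theorem abs_dotProduct_mulVec_self_le {ι : Type*} [Fintype ι] {A : Matrix ι ι ℝ} {c : ℝ}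
    (hA : ∀ i j, |A i j| ≤ c) (u : ι → ℝ) :
    |u ⬝ᵥ A *ᵥ u| ≤ c * (∑ i, |u i|) ^ 2 := by
  calc |u ⬝ᵥ A *ᵥ u| = |∑ i, ∑ j, u i * (A i j * u j)| := by
        simp only [dotProduct, mulVec, Finset.mul_sum]
    _ ≤ ∑ i, ∑ j, |u i * (A i j * u j)| :=
        (Finset.abs_sum_le_sum_abs _ _).trans
          (Finset.sum_le_sum fun i _ => Finset.abs_sum_le_sum_abs _ _)
    _ ≤ ∑ i, ∑ j, c * (|u i| * |u j|) := by
        refine Finset.sum_le_sum fun i _ => Finset.sum_le_sum fun j _ => ?_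
        calc |u i * (A i j * u j)| = |A i j| * (|u i| * |u j|) := by
              rw [abs_mul, abs_mul]; ring
          _ ≤ c * (|u i| * |u j|) := by gcongr; exact hA i j
    _ = c * (∑ i, |u i|) ^ 2 := by
        rw [sq, Finset.sum_mul_sum]
        simp only [Finset.mul_sum]

theorem sq_sum_abs_le_card_support_mul_sum_sq {ι : Type*} [Fintype ι] (u : ι → ℝ) :
    (∑ i, |u i|) ^ 2 ≤ (Finset.univ.filter fun i => u i ≠ 0).card * ∑ i, u i ^ 2 := by
  have hsum : ∑ i, |u i| = ∑ i ∈ Finset.univ.filter (fun i => u i ≠ 0), |u i| :=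
    (Finset.sum_filter_of_ne fun i _ hi => abs_ne_zero.mp hi).symm
  rw [hsum]
  refine sq_sum_le_card_mul_sum_sq.trans ?_
  simp only [sq_abs]
  gcongr
  exact Finset.subset_univ _

theorem sum_sq_mulVec_eq {m ι : Type*} [Fintype m] [Fintype ι] [DecidableEq ι]
    (X : Matrix m ι ℝ) (u : ι → ℝ) :
    ∑ i, (X *ᵥ u) i ^ 2 = ∑ i, u i ^ 2 + u ⬝ᵥ (Xᵀ * X - 1) *ᵥ u := by
  have hX : ∑ i, (X *ᵥ u) i ^ 2 = u ⬝ᵥ (Xᵀ * X) *ᵥ u := by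
    rw [← mulVec_mulVec, dotProduct_mulVec, vecMul_transpose]
    simp only [dotProduct, sq]
  have hu : ∑ i, u i ^ 2 = u ⬝ᵥ u := by simp only [dotProduct, sq]
  rw [hX, hu, sub_mulVec, one_mulVec, dotProduct_sub]
  ring

theorem stmt_3 (n p k : ℕ) (hk : 1 ≤ k) (hkp : k ≤ p) (θ : ℝ) (hθ : 0 < θ) (hθ1 : θ ≤ 1)
    (X : Matrix (Fin n) (Fin p) ℝ)
    (h : ∀ i j, abs ((X.transpose * X - 1 : Matrix (Fin p) (Fin p) ℝ) i j) ≤ θ / k) :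
    RIP n p k θ X := by
  intro u hu hcard
  have hk0 : (0 : ℝ) < k := by exact_mod_cast hk
  have hl1 : (∑ i, |u i|) ^ 2 ≤ k := by
    have hle := sq_sum_abs_le_card_support_mul_sum_sq u
    rw [hu, mul_one] at hle
    exact hle.trans (by exact_mod_cast hcard)
  have hquad : |u ⬝ᵥ (Xᵀ * X - 1) *ᵥ u| ≤ θ :=
    calc |u ⬝ᵥ (Xᵀ * X - 1) *ᵥ u| ≤ θ / k * (∑ i, |u i|) ^ 2 :=
          abs_dotProduct_mulVec_self_le h u
      _ ≤ θ / k * k := by gcongr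
      _ = θ := div_mul_cancel₀ θ hk0.ne'
  rw [sum_sq_mulVec_eq, hu]
  constructor <;> linarith [abs_le.mp hquad]
end

section
/- Let G be a graph on m vertices and K a κ-subset of the vertices such that the number of edges of G with both endpoints in K is at least (1/2+ε)·κ(κ−1)/2, where ε ∈ (0,1/2] and κ ≥ (1+2ε)/ε. Let u_1,…,u_n, w_1,…,w_p be drawn uniformly at random without replacement from the vertex set (all n+p vertices distinct), with n,p < m/2, and set U = {u_1,…,u_n}, W = {w_1,…,w_p}. Define N_{U,W;K} = Σ_{u∈K} Σ_{w∈K} 1{u∈U}·1{w∈W}·1{u∼w}. Then E(N_{U,W;K}) ≥ (1/2+ε/2)·npκ²/m². -/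
open Finset
open scoped Classical

/-- All pairs `(U, W)` of disjoint subsets of the vertex set with `#U = n`, `#W = p`:
the possible outcomes of drawing `n + p` distinct vertices without replacement. -/
noncomputable def pairSets (m n p : ℕ) : Finset (Finset (Fin m) × Finset (Fin m)) :=
  Finset.univ.filter fun UW => UW.1.card = n ∧ UW.2.card = p ∧ Disjoint UW.1 UW.2

/-- `N_{U,W;K} = Σ_{u∈K} Σ_{w∈K} 1{u∈U}·1{w∈W}·1{u∼w}`. -/
noncomputable def NUWK (m : ℕ) (G : SimpleGraph (Fin m)) (K U W : Finset (Fin m)) : ℝ :=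
  ∑ u ∈ K, ∑ w ∈ K, if u ∈ U ∧ w ∈ W ∧ G.Adj u w then 1 else 0

/-- Relabelling the vertices does not change how many outcomes put `u` in `U` and `w` in `W`. -/
theorem card_pairSets_filter_eq {m : ℕ} (n p : ℕ) (σ : Equiv.Perm (Fin m)) (u w : Fin m) :
    #{UW ∈ pairSets m n p | σ u ∈ UW.1 ∧ σ w ∈ UW.2} =
      #{UW ∈ pairSets m n p | u ∈ UW.1 ∧ w ∈ UW.2} := by
  symm
  refine Finset.card_equiv ((Equiv.finsetCongr σ).prodCongr (Equiv.finsetCongr σ)) ?_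
  rintro ⟨U, W⟩
  simp [pairSets]

/-- Any two ordered pairs of distinct vertices are exchanged by some permutation. -/
theorem exists_perm_apply_eq {α : Type*} {u w a b : α} (huw : u ≠ w)
    (hab : a ≠ b) : ∃ σ : Equiv.Perm α, σ u = a ∧ σ w = b := by
  have h : Equiv.swap u a w ≠ a := by
    intro h
    exact huw ((Equiv.swap u a).injective (by rw [h, Equiv.swap_apply_left]))
  refine ⟨(Equiv.swap u a).trans (Equiv.swap (Equiv.swap u a w) b), ?_, ?_⟩
  · simp [Equiv.swap_apply_of_ne_of_ne h.symm hab]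
  · simp

/-- The probability that `u ∈ U` and `w ∈ W` is `n p / (m (m - 1))` for distinct `u` and `w`. -/
theorem mul_card_pairSets_filter {m : ℕ} (n p : ℕ) {u w : Fin m} (huw : u ≠ w) :
    m * (m - 1) * #{UW ∈ pairSets m n p | u ∈ UW.1 ∧ w ∈ UW.2} =
      n * p * #(pairSets m n p) := by
  have hconst : ∀ x ∈ (univ : Finset (Fin m)).offDiag,
      #{UW ∈ pairSets m n p | x.1 ∈ UW.1 ∧ x.2 ∈ UW.2} =
        #{UW ∈ pairSets m n p | u ∈ UW.1 ∧ w ∈ UW.2} := by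
    rintro ⟨a, b⟩ hab
    obtain ⟨σ, rfl, rfl⟩ := exists_perm_apply_eq huw (mem_offDiag.1 hab).2.2
    exact card_pairSets_filter_eq n p σ u w
  have hprod : ∀ UW ∈ pairSets m n p,
      #{x ∈ (univ : Finset (Fin m)).offDiag | x.1 ∈ UW.1 ∧ x.2 ∈ UW.2} = n * p := by
    rintro ⟨U, W⟩ hUW
    obtain ⟨-, hU, hW, hd⟩ := mem_filter.1 hUW
    have : {x ∈ (univ : Finset (Fin m)).offDiag | x.1 ∈ U ∧ x.2 ∈ W} = U ×ˢ W := by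
      ext ⟨a, b⟩
      simp only [mem_filter, mem_offDiag, mem_univ, true_and, mem_product, and_iff_right_iff_imp]
      exact fun h => (disjoint_iff_ne.1 hd) a h.1 b h.2
    rw [this, card_product, hU, hW]
  have h := sum_card_bipartiteAbove_eq_sum_card_bipartiteBelow
    (s := (univ : Finset (Fin m)).offDiag) (t := pairSets m n p)
    (fun x UW => x.1 ∈ UW.1 ∧ x.2 ∈ UW.2)
  simp only [bipartiteAbove, bipartiteBelow] at h
  rw [sum_congr rfl hconst, sum_congr rfl hprod] at h
  simp only [sum_const, offDiag_card, card_univ, Fintype.card_fin, smul_eq_mul] at h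
  rw [Nat.mul_sub, mul_one, h, mul_comm]

theorem pairSets_nonempty {m n p : ℕ} (h : n + p ≤ m) : (pairSets m n p).Nonempty := by
  obtain ⟨U, -, hU⟩ := exists_subset_card_eq (s := (univ : Finset (Fin m))) (n := n)
    (by rw [card_univ, Fintype.card_fin]; omega)
  obtain ⟨W, hWU, hW⟩ := exists_subset_card_eq (s := Uᶜ) (n := p)
    (by rw [card_compl, Fintype.card_fin]; omega)
  refine ⟨(U, W), ?_⟩
  simp only [pairSets, mem_filter, mem_univ, true_and]
  exact ⟨hU, hW, disjoint_compl_right.mono_right hWU⟩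

/-- Each edge inside `K` gives two ordered adjacent pairs of vertices of `K`. -/
theorem card_filter_adj_product {m : ℕ} (G : SimpleGraph (Fin m)) (K : Finset (Fin m)) :
    #{x ∈ K ×ˢ K | G.Adj x.1 x.2} = #{e ∈ G.edgeFinset | ∀ v ∈ e, v ∈ K} * 2 := by
  have hmaps : ∀ x ∈ {x ∈ K ×ˢ K | G.Adj x.1 x.2},
      s(x.1, x.2) ∈ {e ∈ G.edgeFinset | ∀ v ∈ e, v ∈ K} := by
    rintro ⟨a, b⟩ hx
    simp only [mem_filter, mem_product] at hx
    simp [hx]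
  rw [card_eq_sum_card_fiberwise hmaps]
  refine sum_const_nat fun e => ?_
  induction e with | _ a b
  intro he
  simp only [mem_filter, SimpleGraph.mem_edgeFinset, SimpleGraph.mem_edgeSet, Sym2.mem_iff,
    forall_eq_or_imp, forall_eq] at he
  obtain ⟨hab, ha, hb⟩ := he
  have : {x ∈ {x ∈ K ×ˢ K | G.Adj x.1 x.2} | s(x.1, x.2) = s(a, b)} = {(a, b), (b, a)} := by
    ext ⟨c, d⟩
    simp only [mem_filter, mem_product, mem_insert, mem_singleton, Sym2.eq_iff, Prod.mk.injEq,
      and_iff_right_iff_imp]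
    rintro (⟨rfl, rfl⟩ | ⟨rfl, rfl⟩)
    · exact ⟨⟨ha, hb⟩, hab⟩
    · exact ⟨⟨hb, ha⟩, hab.symm⟩
  rw [this, card_pair]
  simp [hab.ne]

/-- Summing `N_{U,W;K}` over outcomes counts, for each adjacent pair, the outcomes selecting it. -/
theorem sum_NUWK_eq (m n p : ℕ) (G : SimpleGraph (Fin m)) (K : Finset (Fin m)) :
    ∑ UW ∈ pairSets m n p, NUWK m G K UW.1 UW.2 =
      ∑ x ∈ K ×ˢ K with G.Adj x.1 x.2,
        (#{UW ∈ pairSets m n p | x.1 ∈ UW.1 ∧ x.2 ∈ UW.2} : ℝ) := by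
  have hN : ∀ UW ∈ pairSets m n p, NUWK m G K UW.1 UW.2 =
      ∑ x ∈ K ×ˢ K, if x.1 ∈ UW.1 ∧ x.2 ∈ UW.2 ∧ G.Adj x.1 x.2 then 1 else 0 :=
    fun UW _ => by rw [NUWK, sum_product]
  rw [sum_congr rfl hN, sum_comm, sum_filter]
  refine sum_congr rfl fun x _ => ?_
  split_ifs with h <;> simp [h]

theorem stmt_7 (m n p κ : ℕ) (ε : ℝ) (hε : 0 < ε) (hε2 : ε ≤ 1 / 2)
    (G : SimpleGraph (Fin m)) (K : Finset (Fin m)) (hK : K.card = κ)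
    (hκ : (1 + 2 * ε) / ε ≤ (κ : ℝ))
    (hdense : (1 / 2 + ε) * (κ * (κ - 1) / 2) ≤
      ((G.edgeFinset.filter fun e => ∀ v ∈ e, v ∈ K).card : ℝ))
    (hn : 2 * n < m) (hp : 2 * p < m) :
    (1 / 2 + ε / 2) * (n * p * κ ^ 2 / m ^ 2) ≤
      (∑ UW ∈ pairSets m n p, NUWK m G K UW.1 UW.2) /
        ((pairSets m n p).card : ℝ) := by
  have hκ' : 1 + 2 * ε ≤ κ * ε := (div_le_iff₀ hε).1 hκ
  have hm : (1 : ℝ) < m := by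
    have hκm : κ ≤ m := by simpa [hK] using card_le_univ K
    have hκ2 : (2 : ℝ) < κ := by nlinarith
    have : (κ : ℝ) ≤ m := by exact_mod_cast hκm
    linarith
  have hP : (0 : ℝ) < #(pairSets m n p) := by
    exact_mod_cast (pairSets_nonempty (by omega : n + p ≤ m)).card_pos
  have hc : ∀ x ∈ {x ∈ K ×ˢ K | G.Adj x.1 x.2},
      (#{UW ∈ pairSets m n p | x.1 ∈ UW.1 ∧ x.2 ∈ UW.2} : ℝ) =
        n * p * #(pairSets m n p) / (m * (m - 1)) := by
    intro x hx
    rw [eq_div_iff (by nlinarith), mul_comm]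
    have h := mul_card_pairSets_filter n p (mem_filter.1 hx).2.ne
    rw [← Nat.cast_inj (R := ℝ)] at h
    push_cast [Nat.cast_pred (by exact_mod_cast (zero_lt_one.trans hm) : 0 < m)] at h
    exact h
  rw [sum_NUWK_eq, sum_congr rfl hc, sum_const, card_filter_adj_product, nsmul_eq_mul]
  push_cast
  set e : ℝ := (#{e ∈ G.edgeFinset | ∀ v ∈ e, v ∈ K} : ℝ)
  have he : (1 / 2 + ε / 2) * κ ^ 2 ≤ e * 2 := by
    have hκ0 : (0 : ℝ) ≤ κ := κ.cast_nonneg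
    nlinarith [mul_nonneg hκ0 (sub_nonneg.2 hκ')]
  calc (1 / 2 + ε / 2) * (n * p * κ ^ 2 / m ^ 2)
      = (1 / 2 + ε / 2) * κ ^ 2 * (n * p) / m ^ 2 := by ring
    _ ≤ e * 2 * (n * p) / (m * (m - 1)) := by
      have h0 : (0 : ℝ) < m * (m - 1) := by nlinarith
      have h1 : (m : ℝ) * (m - 1) ≤ m ^ 2 := by nlinarith
      have he0 : 0 ≤ e := Nat.cast_nonneg _
      gcongr
    _ = e * 2 * (n * p * #(pairSets m n p) / (m * (m - 1))) / #(pairSets m n p) := by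
      field_simp
end

section
/- Let G be a graph on m vertices and K a κ-subset of the vertices. Let u_1,…,u_n, w_1,…,w_p be drawn uniformly at random without replacement from the vertex set (all n+p vertices distinct), with m > 2n and m > 2p, and set U = {u_1,…,u_n}, W = {w_1,…,w_p}. Define N_{U,W;K} = Σ_{u∈K} Σ_{w∈K} 1{u∈U}·1{w∈W}·1{u∼w}. Then Var(N_{U,W;K}) ≤ (npκ²/m²)·(pκ/m + nκ/m + 1). -/
open Finset
open scoped Classical

/-- The number of outcomes `(U, W)` with `A ⊆ U` and `B ⊆ W`. -/
noncomputable def containCount (m n p : ℕ) (A B : Finset (Fin m)) : ℕ :=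
  #{UW ∈ pairSets m n p | A ⊆ UW.1 ∧ B ⊆ UW.2}

theorem containCount_empty (m n p : ℕ) : containCount m n p ∅ ∅ = #(pairSets m n p) := by
  simp [containCount]

theorem containCount_comm (m n p : ℕ) (A B : Finset (Fin m)) :
    containCount m n p A B = containCount m p n B A := by
  refine Finset.card_equiv (Equiv.prodComm _ _) fun UW => ?_
  simp only [pairSets, mem_filter, mem_univ, true_and, Equiv.prodComm_apply, Prod.fst_swap,
    Prod.snd_swap, disjoint_comm (a := UW.2)]
  tauto

theorem containCount_map (m n p : ℕ) (σ : Equiv.Perm (Fin m)) (A B : Finset (Fin m)) :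
    containCount m n p (A.map σ.toEmbedding) (B.map σ.toEmbedding) = containCount m n p A B := by
  refine (Finset.card_equiv (σ.finsetCongr.prodCongr σ.finsetCongr) fun UW => ?_).symm
  simp [pairSets]

theorem containCount_eq_zero (m n p : ℕ) {A B : Finset (Fin m)} (h : ¬Disjoint A B) :
    containCount m n p A B = 0 := by
  simp only [containCount, card_eq_zero, filter_eq_empty_iff, pairSets, mem_filter, mem_univ,
    true_and]
  rintro UW ⟨-, -, hd⟩ ⟨hA, hB⟩
  exact h (hd.mono hA hB)

theorem map_swap_eq_self {α : Type*} [DecidableEq α] {x y : α} {A : Finset α}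
    (hx : x ∉ A) (hy : y ∉ A) : A.map (Equiv.swap x y).toEmbedding = A := by
  refine Finset.eq_of_subset_of_card_le (fun z hz => ?_) (by simp)
  obtain ⟨a, ha, rfl⟩ := Finset.mem_map.1 hz
  have h1 : a ≠ x := fun h => hx (h ▸ ha)
  have h2 : a ≠ y := fun h => hy (h ▸ ha)
  simpa [Equiv.swap_apply_of_ne_of_ne h1 h2] using ha

theorem containCount_insert_congr (m n p : ℕ) {A B : Finset (Fin m)} {x y : Fin m}
    (hxA : x ∉ A) (hxB : x ∉ B) (hyA : y ∉ A) (hyB : y ∉ B) :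
    containCount m n p (insert y A) B = containCount m n p (insert x A) B := by
  rw [← containCount_map m n p (Equiv.swap x y) (insert x A) B, map_insert,
    map_swap_eq_self hxA hyA, map_swap_eq_self hxB hyB]
  simp

theorem sum_containCount_insert (m n p : ℕ) (A B : Finset (Fin m)) :
    ∑ x ∈ (A ∪ B)ᶜ, (containCount m n p (insert x A) B : ℝ) =
      (n - #A) * containCount m n p A B := by
  have key : ∀ UW ∈ {UW ∈ pairSets m n p | A ⊆ UW.1 ∧ B ⊆ UW.2},
      ∑ x ∈ (A ∪ B)ᶜ, (if x ∈ UW.1 then (1 : ℝ) else 0) = n - #A := by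
    intro UW h
    simp only [pairSets, mem_filter, mem_univ, true_and] at h
    obtain ⟨⟨hn, -, hd⟩, hA, hB⟩ := h
    have : {x ∈ (A ∪ B)ᶜ | x ∈ UW.1} = UW.1 \ A := by
      ext x
      have : x ∈ UW.1 → x ∉ B := fun h1 h2 => disjoint_left.1 hd h1 (hB h2)
      simp only [mem_filter, mem_compl, mem_union, mem_sdiff]
      tauto
    rw [← Finset.sum_filter, this, sum_const, nsmul_one, cast_card_sdiff hA, hn]
  calc
    _ = ∑ x ∈ (A ∪ B)ᶜ, ∑ UW ∈ pairSets m n p with A ⊆ UW.1 ∧ B ⊆ UW.2,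
          (if x ∈ UW.1 then (1 : ℝ) else 0) := by
      refine sum_congr rfl fun x _ => ?_
      rw [← Finset.sum_filter, sum_const, nsmul_one, filter_filter, containCount]
      congr 2
      ext UW
      simp only [mem_filter, insert_subset_iff]
      tauto
    _ = _ := by
      rw [sum_comm, sum_congr rfl key, sum_const, nsmul_eq_mul, mul_comm, containCount]

theorem containCount_insert_left (m n p : ℕ) {A B : Finset (Fin m)} {x : Fin m}
    (hAB : Disjoint A B) (hxA : x ∉ A) (hxB : x ∉ B) :
    (m - #A - #B : ℝ) * containCount m n p (insert x A) B =
      (n - #A) * containCount m n p A B := by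
  rw [← sum_containCount_insert m n p A B]
  have h : ∀ y ∈ (A ∪ B)ᶜ, (containCount m n p (insert y A) B : ℝ) =
      containCount m n p (insert x A) B := by
    intro y hy
    simp only [mem_compl, mem_union, not_or] at hy
    rw [containCount_insert_congr m n p hxA hxB hy.1 hy.2]
  rw [sum_congr rfl h, sum_const, nsmul_eq_mul]
  have hc : #(A ∪ B)ᶜ + (#A + #B) = m := by
    rw [← card_union_of_disjoint hAB, card_compl_add_card, Fintype.card_fin]
  have hc' : (#(A ∪ B)ᶜ : ℝ) + (#A + #B) = m := by exact_mod_cast hc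
  rw [← hc']
  ring

theorem containCount_insert_right (m n p : ℕ) {A B : Finset (Fin m)} {x : Fin m}
    (hAB : Disjoint A B) (hxA : x ∉ A) (hxB : x ∉ B) :
    (m - #A - #B : ℝ) * containCount m n p A (insert x B) =
      (p - #B) * containCount m n p A B := by
  rw [containCount_comm m n p A (insert x B), containCount_comm m n p A B,
    ← containCount_insert_left m p n hAB.symm hxB hxA]
  ring

theorem containCount_one_one (m n p : ℕ) {u w : Fin m} (huw : u ≠ w) :
    (containCount m n p {u} {w} : ℝ) =
      #(pairSets m n p) * (n * p / (m * (m - 1))) := by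
  have hm : 2 ≤ m := by
    have := card_le_univ ({u, w} : Finset (Fin m))
    rwa [card_pair huw, Fintype.card_fin] at this
  have hm' : (2 : ℝ) ≤ m := by exact_mod_cast hm
  have h1 := containCount_insert_left m n p (A := ∅) (B := ∅) (x := u) (by simp) (by simp) (by simp)
  have h2 := containCount_insert_right m n p (A := {u}) (B := ∅) (x := w) (by simp)
    (by simpa using huw.symm) (by simp)
  simp only [containCount_empty, insert_empty_eq, card_empty, card_singleton] at h1 h2
  push_cast at h1 h2
  have : (m : ℝ) - 1 ≠ 0 := by linarith
  have : (m : ℝ) ≠ 0 := by linarith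
  field_simp
  linear_combination m * h2 + p * h1

theorem containCount_one_two (m n p : ℕ) {u w w' : Fin m} (huw : u ≠ w) (huw' : u ≠ w')
    (hww' : w ≠ w') :
    (containCount m n p {u} {w, w'} : ℝ) =
      #(pairSets m n p) * (n * p * (p - 1) / (m * (m - 1) * (m - 2))) := by
  have hm : 3 ≤ m := by
    have := card_le_univ ({u, w, w'} : Finset (Fin m))
    rwa [card_eq_three.2 ⟨u, w, w', huw, huw', hww', rfl⟩, Fintype.card_fin] at this
  have hm' : (3 : ℝ) ≤ m := by exact_mod_cast hm
  have h := containCount_insert_right m n p (A := {u}) (B := {w'}) (x := w) (by simpa)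
    (by simpa using huw.symm) (by simpa)
  rw [containCount_one_one m n p huw'] at h
  simp only [card_singleton] at h
  push_cast at h
  have h1 : (m : ℝ) - 1 ≠ 0 := by linarith
  have h2 : (m : ℝ) - 2 ≠ 0 := by linarith
  have h0 : (m : ℝ) ≠ 0 := by linarith
  rw [show (m : ℝ) - 1 - 1 = m - 2 by ring] at h
  field_simp at h ⊢
  linear_combination h

theorem containCount_two_one (m n p : ℕ) {u u' w : Fin m} (huw : u ≠ w) (huw' : u' ≠ w)
    (huu' : u ≠ u') :
    (containCount m n p {u, u'} {w} : ℝ) =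
      #(pairSets m n p) * (n * p * (n - 1) / (m * (m - 1) * (m - 2))) := by
  have hcard : #(pairSets m p n) = #(pairSets m n p) := by
    rw [← containCount_empty, ← containCount_empty, containCount_comm]
  rw [containCount_comm, containCount_one_two m p n huw.symm huw'.symm huu', hcard]
  ring

theorem containCount_two_two (m n p : ℕ) {u u' w w' : Fin m} (h₁ : u ≠ w) (h₂ : u ≠ w')
    (h₃ : u' ≠ w) (h₄ : u' ≠ w') (h₅ : u ≠ u') (h₆ : w ≠ w') :
    (containCount m n p {u, u'} {w, w'} : ℝ) =
      #(pairSets m n p) *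
        (n * p * (n - 1) * (p - 1) / (m * (m - 1) * (m - 2) * (m - 3))) := by
  have hm : 4 ≤ m := by
    have := card_le_univ ({u, u', w, w'} : Finset (Fin m))
    rwa [card_insert_of_notMem (by simp [*]),
      card_eq_three.2 ⟨u', w, w', h₃, h₄, h₆, rfl⟩, Fintype.card_fin] at this
  have hm' : (4 : ℝ) ≤ m := by exact_mod_cast hm
  have h := containCount_insert_right m n p (A := {u, u'}) (B := {w'}) (x := w)
    (by simp [h₂.symm, h₄.symm])
    (by simp [h₁.symm, h₃.symm]) (by simpa)
  rw [containCount_two_one m n p h₂ h₄ h₅, card_pair h₅] at h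
  simp only [card_singleton] at h
  push_cast at h
  have h1 : (m : ℝ) - 1 ≠ 0 := by linarith
  have h2 : (m : ℝ) - 2 ≠ 0 := by linarith
  have h3 : (m : ℝ) - 3 ≠ 0 := by linarith
  have h0 : (m : ℝ) ≠ 0 := by linarith
  rw [show (m : ℝ) - 2 - 1 = m - 3 by ring] at h
  field_simp at h ⊢
  linear_combination h

/-- The ordered pairs of adjacent vertices of `K`. -/
noncomputable def adjPairs {m : ℕ} (G : SimpleGraph (Fin m)) (K : Finset (Fin m)) :
    Finset (Fin m × Fin m) :=
  {e ∈ K ×ˢ K | G.Adj e.1 e.2}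

theorem NUWK_eq_sum_adjPairs (m : ℕ) (G : SimpleGraph (Fin m)) (K U W : Finset (Fin m)) :
    NUWK m G K U W = ∑ e ∈ adjPairs G K, if {e.1} ⊆ U ∧ {e.2} ⊆ W then 1 else 0 := by
  rw [NUWK, adjPairs, sum_filter, sum_product]
  refine sum_congr rfl fun u _ => sum_congr rfl fun w _ => ?_
  simp only [singleton_subset_iff]
  split_ifs <;> tauto

theorem sum_NUWK (m n p : ℕ) (G : SimpleGraph (Fin m)) (K : Finset (Fin m)) :
    ∑ UW ∈ pairSets m n p, NUWK m G K UW.1 UW.2 =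
      #(pairSets m n p) * (#(adjPairs G K) * (n * p / (m * (m - 1)))) := by
  simp only [NUWK_eq_sum_adjPairs]
  rw [sum_comm]
  have h : ∀ e ∈ adjPairs G K,
      ∑ UW ∈ pairSets m n p, (if {e.1} ⊆ UW.1 ∧ {e.2} ⊆ UW.2 then (1 : ℝ) else 0) =
        #(pairSets m n p) * (n * p / (m * (m - 1))) := by
    intro e he
    rw [← containCount_one_one m n p (mem_filter.1 he).2.ne, ← sum_filter, sum_const, nsmul_one,
      containCount]
  rw [sum_congr rfl h, sum_const, nsmul_eq_mul]
  ring

theorem sum_NUWK_sq (m n p : ℕ) (G : SimpleGraph (Fin m)) (K : Finset (Fin m)) :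
    ∑ UW ∈ pairSets m n p, NUWK m G K UW.1 UW.2 ^ 2 =
      ∑ e ∈ adjPairs G K, ∑ f ∈ adjPairs G K,
        (containCount m n p {e.1, f.1} {e.2, f.2} : ℝ) := by
  simp only [NUWK_eq_sum_adjPairs, sq, sum_mul_sum]
  rw [sum_comm]
  refine sum_congr rfl fun e _ => ?_
  rw [sum_comm]
  refine sum_congr rfl fun f _ => ?_
  rw [containCount, ← nsmul_one, ← sum_const, sum_filter]
  refine sum_congr rfl fun UW _ => ?_
  simp only [singleton_subset_iff, insert_subset_iff]
  split_ifs <;> first | tauto | norm_num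

theorem card_adjPairs_le {m : ℕ} (G : SimpleGraph (Fin m)) (K : Finset (Fin m)) :
    (#(adjPairs G K) : ℝ) ≤ #K * (#K - 1) := by
  have h : #(adjPairs G K) ≤ #K * #K - #K := by
    rw [← offDiag_card]
    refine card_le_card fun e he => ?_
    simp only [adjPairs, mem_filter, mem_product] at he
    exact mem_offDiag.2 ⟨he.1.1, he.1.2, he.2.ne⟩
  have h' : #(adjPairs G K) + #K ≤ #K * #K := by
    have := Nat.le_mul_self #K
    lia
  have : (#(adjPairs G K) : ℝ) + #K ≤ #K * #K := by exact_mod_cast h'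
  linarith

theorem card_erase_erase {α : Type*} [DecidableEq α] {K : Finset α} {u w : α} (hu : u ∈ K)
    (hw : w ∈ K) (h : u ≠ w) : (#((K.erase u).erase w) : ℝ) = #K - 2 := by
  rw [cast_card_erase_of_mem (mem_erase.2 ⟨h.symm, hw⟩), cast_card_erase_of_mem hu]
  ring

theorem card_adjPairs_fst_eq_le {m : ℕ} (G : SimpleGraph (Fin m)) (K : Finset (Fin m))
    {e : Fin m × Fin m} (he : e ∈ adjPairs G K) :
    (#{f ∈ adjPairs G K | e.1 = f.1 ∧ e.2 ≠ f.2} : ℝ) ≤ #K - 2 := by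
  simp only [adjPairs, mem_filter, mem_product] at he
  rw [← card_erase_erase he.1.1 he.1.2 he.2.ne, Nat.cast_le]
  refine card_le_card_of_injOn Prod.snd (fun f hf => ?_) fun f hf g hg hfg => ?_
  · simp only [adjPairs, coe_filter, mem_filter, mem_product, Set.mem_ofPred_eq] at hf
    obtain ⟨⟨⟨-, hK⟩, hadj⟩, h1, h2⟩ := hf
    exact mem_coe.2 (mem_erase.2 ⟨h2.symm, mem_erase.2 ⟨h1 ▸ hadj.ne.symm, hK⟩⟩)
  · exact Prod.ext ((mem_filter.1 hf).2.1.symm.trans (mem_filter.1 hg).2.1) hfg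

theorem card_adjPairs_snd_eq_le {m : ℕ} (G : SimpleGraph (Fin m)) (K : Finset (Fin m))
    {e : Fin m × Fin m} (he : e ∈ adjPairs G K) :
    (#{f ∈ adjPairs G K | e.1 ≠ f.1 ∧ e.2 = f.2} : ℝ) ≤ #K - 2 := by
  simp only [adjPairs, mem_filter, mem_product] at he
  rw [← card_erase_erase he.1.1 he.1.2 he.2.ne, Nat.cast_le]
  refine card_le_card_of_injOn Prod.fst (fun f hf => ?_) fun f hf g hg hfg => ?_
  · simp only [adjPairs, coe_filter, mem_filter, mem_product, Set.mem_ofPred_eq] at hf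
    obtain ⟨⟨⟨hK, -⟩, hadj⟩, h1, h2⟩ := hf
    exact mem_coe.2 (mem_erase.2 ⟨h2 ▸ hadj.ne, mem_erase.2 ⟨h1.symm, hK⟩⟩)
  · exact Prod.ext hfg ((mem_filter.1 hf).2.2.symm.trans (mem_filter.1 hg).2.2)

theorem containCount_pair_le (m n p : ℕ) {q₁ q₂ q₃ q₄ : ℝ}
    (hq₁ : q₁ = n * p / (m * (m - 1)))
    (hq₂ : q₂ = n * p * (p - 1) / (m * (m - 1) * (m - 2)))
    (hq₃ : q₃ = n * p * (n - 1) / (m * (m - 1) * (m - 2)))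
    (hq₄ : q₄ = n * p * (n - 1) * (p - 1) / (m * (m - 1) * (m - 2) * (m - 3)))
    (h₄ : 0 ≤ q₄) {e f : Fin m × Fin m} (he : e.1 ≠ e.2) (hf : f.1 ≠ f.2) :
    (containCount m n p {e.1, f.1} {e.2, f.2} : ℝ) ≤
      #(pairSets m n p) * (q₄ + ((if e = f then q₁ else 0) +
        ((if e.1 = f.1 ∧ e.2 ≠ f.2 then q₂ else 0) +
          if e.1 ≠ f.1 ∧ e.2 = f.2 then q₃ else 0))) := by
  obtain ⟨u, w⟩ := e
  obtain ⟨u', w'⟩ := f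
  simp only [Prod.mk.injEq] at he hf ⊢
  have hC : (0 : ℝ) ≤ #(pairSets m n p) * q₄ := by positivity
  by_cases h1 : u = u'
  · subst h1
    by_cases h2 : w = w'
    · subst h2
      simp only [pair_eq_singleton, containCount_one_one m n p he, ← hq₁]
      simp only [and_self, if_true, ne_eq, not_true_eq_false, and_false, false_and, if_false]
      linarith
    · simp only [pair_eq_singleton, containCount_one_two m n p he hf h2, ← hq₂]
      simp only [h2, and_false, if_false, ne_eq, not_false_eq_true, and_true, if_true,
        not_true_eq_false]
      linarith
  · by_cases h2 : w = w'
    · subst h2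
      simp only [pair_eq_singleton, containCount_two_one m n p he hf h1, ← hq₃]
      simp only [h1, false_and, if_false, ne_eq, not_false_eq_true, and_true, if_true]
      linarith
    · simp only [h1, h2, false_and, and_false, if_false, add_zero]
      by_cases h3 : u = w'
      · rw [containCount_eq_zero m n p (by simp [h3])]
        simpa using hC
      by_cases h4 : u' = w
      · rw [containCount_eq_zero m n p (by simp [h4])]
        simpa using hC
      rw [containCount_two_two m n p he h3 h4 hf h1 h2, ← hq₄]

theorem sum_NUWK_sq_le (m n p : ℕ) (G : SimpleGraph (Fin m)) (K : Finset (Fin m))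
    {q₁ q₂ q₃ q₄ : ℝ}
    (hq₁ : q₁ = n * p / (m * (m - 1)))
    (hq₂ : q₂ = n * p * (p - 1) / (m * (m - 1) * (m - 2)))
    (hq₃ : q₃ = n * p * (n - 1) / (m * (m - 1) * (m - 2)))
    (hq₄ : q₄ = n * p * (n - 1) * (p - 1) / (m * (m - 1) * (m - 2) * (m - 3)))
    (h₂ : 0 ≤ q₂) (h₃ : 0 ≤ q₃) (h₄ : 0 ≤ q₄) :
    ∑ UW ∈ pairSets m n p, NUWK m G K UW.1 UW.2 ^ 2 ≤
      #(pairSets m n p) * (#(adjPairs G K) ^ 2 * q₄ + #(adjPairs G K) * q₁ +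
        #(adjPairs G K) * (#K - 2) * (q₂ + q₃)) := by
  rw [sum_NUWK_sq]
  calc
    _ ≤ ∑ e ∈ adjPairs G K, #(pairSets m n p) *
          (#(adjPairs G K) * q₄ + (q₁ + ((#K - 2) * q₂ + (#K - 2) * q₃))) := by
      refine sum_le_sum fun e he => ?_
      refine (sum_le_sum fun f hf => containCount_pair_le m n p hq₁ hq₂ hq₃ hq₄ h₄
        (mem_filter.1 he).2.ne (mem_filter.1 hf).2.ne).trans ?_
      rw [← mul_sum]
      refine mul_le_mul_of_nonneg_left ?_ (Nat.cast_nonneg _)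
      rw [sum_add_distrib, sum_add_distrib, sum_add_distrib, sum_ite_eq, if_pos he,
        ← sum_filter, ← sum_filter]
      simp only [sum_const, nsmul_eq_mul]
      gcongr
      · exact card_adjPairs_fst_eq_le G K he
      · exact card_adjPairs_snd_eq_le G K he
    _ = _ := by
      rw [sum_const, nsmul_eq_mul]
      ring

theorem pred_mul_pred_div_le {m n p : ℝ} (hm : 3 ≤ m) (hn : 1 ≤ n) (hp : 1 ≤ p)
    (hnm : 2 * n + 1 ≤ m) (hpm : 2 * p + 1 ≤ m) :
    n * p * (n - 1) * (p - 1) / (m * (m - 1) * (m - 2) * (m - 3)) ≤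
      (n * p / (m * (m - 1))) ^ 2 := by
  rcases hm.eq_or_lt with rfl | hm
  · norm_num
    positivity
  have h3 : 0 < m - 3 := by linarith
  have h2 : 0 < m - 2 := by linarith
  have h1 : 0 < m - 1 := by linarith
  have h0 : 0 < m := by linarith
  have ha : (n - 1) * (m - 1) ≤ n * (m - 3) := by nlinarith
  have hb : (p - 1) * m ≤ p * (m - 2) := by nlinarith
  have hab : ((n - 1) * (m - 1)) * ((p - 1) * m) ≤ (n * (m - 3)) * (p * (m - 2)) :=
    mul_le_mul ha hb (mul_nonneg (by linarith) h0.le) (mul_nonneg (by linarith) h3.le)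
  rw [div_pow, div_le_div_iff₀ (by positivity) (by positivity)]
  have := mul_le_mul_of_nonneg_left hab (by positivity : 0 ≤ n * p * (m * (m - 1)))
  linarith

theorem variance_bound {m n p κ S : ℝ} (hm : 3 ≤ m) (hn : 1 ≤ n) (hp : 1 ≤ p)
    (hnm : 2 * n + 1 ≤ m) (hpm : 2 * p + 1 ≤ m) (hκ : 2 ≤ κ) (hκm : κ ≤ m)
    (hS : S ≤ κ * (κ - 1)) :
    S ^ 2 * (n * p * (n - 1) * (p - 1) / (m * (m - 1) * (m - 2) * (m - 3))) +
        S * (n * p / (m * (m - 1))) +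
        S * (κ - 2) * (n * p * (p - 1) / (m * (m - 1) * (m - 2)) +
          n * p * (n - 1) / (m * (m - 1) * (m - 2))) -
        (S * (n * p / (m * (m - 1)))) ^ 2 ≤
      (n * p * κ ^ 2 / m ^ 2) * (p * κ / m + n * κ / m + 1) := by
  have h2 : 0 < m - 2 := by linarith
  have h1 : 0 < m - 1 := by linarith
  have h0 : 0 < m := by linarith
  have k2 : 0 ≤ κ - 2 := by linarith
  have k1 : 0 ≤ κ - 1 := by linarith
  have hS1 : S / (m * (m - 1)) ≤ κ ^ 2 / m ^ 2 := by
    rw [div_le_div_iff₀ (by positivity) (by positivity)]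
    have : (κ - 1) * m ≤ κ * (m - 1) := by linarith
    have := mul_le_mul_of_nonneg_left this (by positivity : 0 ≤ κ * m)
    have := mul_le_mul_of_nonneg_right hS (by positivity : 0 ≤ m ^ 2)
    linarith
  have hr : (κ - 2) / (m - 2) ≤ κ / m := by
    rw [div_le_div_iff₀ h2 h0]
    linarith
  have hS2 : S / (m * (m - 1)) * ((κ - 2) / (m - 2)) ≤ κ ^ 2 / m ^ 2 * (κ / m) :=
    mul_le_mul hS1 hr (by positivity) (by positivity)
  have hq := mul_le_mul_of_nonneg_left (pred_mul_pred_div_le hm hn hp hnm hpm) (sq_nonneg S)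
  have hA := mul_le_mul_of_nonneg_left hS1 (by positivity : 0 ≤ n * p)
  have hB := mul_le_mul_of_nonneg_left hS2
    (mul_nonneg (by positivity) (by linarith) : 0 ≤ n * p * (n + p - 2))
  have hC : n * p * (n + p - 2) * (κ ^ 2 / m ^ 2 * (κ / m)) ≤
      n * p * (n + p) * (κ ^ 2 / m ^ 2 * (κ / m)) := by
    gcongr
    linarith
  have e1 : S * (n * p / (m * (m - 1))) = n * p * (S / (m * (m - 1))) := by ring
  have e2 : S * (κ - 2) * (n * p * (p - 1) / (m * (m - 1) * (m - 2)) +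
      n * p * (n - 1) / (m * (m - 1) * (m - 2))) =
      n * p * (n + p - 2) * (S / (m * (m - 1)) * ((κ - 2) / (m - 2))) := by
    field_simp
    ring
  have e3 : (n * p * κ ^ 2 / m ^ 2) * (p * κ / m + n * κ / m + 1) =
      n * p * (n + p) * (κ ^ 2 / m ^ 2 * (κ / m)) + n * p * (κ ^ 2 / m ^ 2) := by ring
  rw [e2, e3, mul_pow]
  linarith

theorem stmt_8 (m n p κ : ℕ)
    (G : SimpleGraph (Fin m)) (K : Finset (Fin m)) (hK : K.card = κ)
    (hn : 2 * n < m) (hp : 2 * p < m) :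
    (∑ UW ∈ pairSets m n p, (NUWK m G K UW.1 UW.2) ^ 2) / ((pairSets m n p).card : ℝ) -
        ((∑ UW ∈ pairSets m n p, NUWK m G K UW.1 UW.2) / ((pairSets m n p).card : ℝ)) ^ 2 ≤
      (n * p * κ ^ 2 / m ^ 2) * (p * κ / m + n * κ / m + 1) := by
  have hC : (0 : ℝ) < #(pairSets m n p) := by
    exact_mod_cast card_pos.2 (pairSets_nonempty (m := m) (n := n) (p := p) (by lia))
  have hS := card_adjPairs_le G K
  rw [hK] at hS
  rw [sum_NUWK, mul_div_cancel_left₀ _ hC.ne']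
  rcases Nat.eq_zero_or_pos n with rfl | hn0
  · have h := sum_NUWK_sq_le m 0 p G K rfl rfl rfl rfl (by simp) (by simp) (by simp)
    have := div_nonpos_of_nonpos_of_nonneg (h.trans_eq (by simp)) hC.le
    simpa using this
  rcases Nat.eq_zero_or_pos p with rfl | hp0
  · have h := sum_NUWK_sq_le m n 0 G K rfl rfl rfl rfl (by simp) (by simp) (by simp)
    have := div_nonpos_of_nonpos_of_nonneg (h.trans_eq (by simp)) hC.le
    simpa using this
  have hn1 : (1 : ℝ) ≤ n := by exact_mod_cast hn0
  have hp1 : (1 : ℝ) ≤ p := by exact_mod_cast hp0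
  have hnm : 2 * (n : ℝ) + 1 ≤ m := by exact_mod_cast hn
  have hpm : 2 * (p : ℝ) + 1 ≤ m := by exact_mod_cast hp
  have hm3 : (3 : ℝ) ≤ m := by linarith
  have n1 : (0 : ℝ) ≤ n - 1 := by linarith
  have p1 : (0 : ℝ) ≤ p - 1 := by linarith
  have m1 : (0 : ℝ) ≤ m - 1 := by linarith
  have m2 : (0 : ℝ) ≤ m - 2 := by linarith
  have m3 : (0 : ℝ) ≤ m - 3 := by linarith
  have h := sum_NUWK_sq_le m n p G K rfl rfl rfl rfl (by positivity) (by positivity)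
    (by positivity)
  rw [← div_le_iff₀' hC, hK] at h
  refine (sub_le_sub_right h _).trans ?_
  rcases Nat.lt_or_ge κ 2 with hκ | hκ
  · have hS0 : (#(adjPairs G K) : ℝ) = 0 := by
      refine le_antisymm (hS.trans ?_) (Nat.cast_nonneg _)
      interval_cases κ <;> norm_num
    rw [hS0]
    simp only [ne_eq, OfNat.ofNat_ne_zero, not_false_eq_true, zero_pow, zero_mul, add_zero,
      sub_zero]
    positivity
  · refine variance_bound hm3 hn1 hp1 hnm hpm (by exact_mod_cast hκ) ?_ hS
    have := card_le_univ K
    rw [hK, Fintype.card_fin] at this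
    exact_mod_cast this
end

section
/- Let Z be a nonnegative real random variable with E(Z^r) < ∞ for a real number r ≥ 2. Then E(|Z − E(Z)|^r) ≤ E(Z^r). That is, centring a nonnegative random variable does not increase its r-th absolute moment for any r ≥ 2. -/
open MeasureTheory

/-- A tangent-type bound for `z ↦ |z - m| ^ r`, with a correction that is linear in `z - m`. -/
theorem abs_sub_rpow_le_rpow_sub_mul {z m r : ℝ} (hz : 0 ≤ z) (hm : 0 ≤ m) (hr : 2 ≤ r) :
    |z - m| ^ r ≤ z ^ r - m ^ (r - 1) * (z - m) := by
  have hsplit : ∀ x : ℝ, 0 ≤ x → x ^ r = x ^ (r - 1) * x := fun x hx => by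
    rw [← Real.rpow_add_one' hx (by linarith), sub_add_cancel]
  have hmp : 0 ≤ m ^ (r - 1) := Real.rpow_nonneg hm _
  rcases le_total m z with h | h
  · have ht : 0 ≤ z - m := sub_nonneg.2 h
    have hadd : m ^ (r - 1) + (z - m) ^ (r - 1) ≤ z ^ (r - 1) := by
      simpa using Real.add_rpow_le_rpow_add hm ht (by linarith : 1 ≤ r - 1)
    have htp : 0 ≤ (z - m) ^ (r - 1) := Real.rpow_nonneg ht _
    rw [abs_of_nonneg ht, hsplit _ ht, hsplit _ hz]
    nlinarith [mul_le_mul_of_nonneg_right hadd hz, mul_nonneg htp hm, mul_nonneg hmp hm]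
  · have hs : 0 ≤ m - z := sub_nonneg.2 h
    have hle : (m - z) ^ (r - 1) ≤ m ^ (r - 1) :=
      Real.rpow_le_rpow hs (by linarith) (by linarith)
    rw [abs_sub_comm, abs_of_nonneg hs, hsplit _ hs]
    nlinarith [mul_le_mul_of_nonneg_right hle hs, Real.rpow_nonneg hz r]

theorem stmt_10 {Ω : Type*} [MeasurableSpace Ω] (μ : Measure Ω) [IsProbabilityMeasure μ]
    (Z : Ω → ℝ) (hZmeas : Measurable Z) (hZnonneg : ∀ᵐ ω ∂μ, 0 ≤ Z ω)
    (r : ℝ) (hr : 2 ≤ r) (hint : Integrable (fun ω => Z ω ^ r) μ) :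
    ∫ ω, |Z ω - ∫ x, Z x ∂μ| ^ r ∂μ ≤ ∫ ω, Z ω ^ r ∂μ := by
  have hZ : Integrable Z μ := by
    refine ((integrable_const (1 : ℝ)).add hint).mono' hZmeas.aestronglyMeasurable ?_
    filter_upwards [hZnonneg] with ω hω
    rw [Real.norm_of_nonneg hω, Pi.add_apply]
    rcases le_total (Z ω) 1 with h | h
    · linarith [Real.rpow_nonneg hω r]
    · linarith [Real.self_le_rpow_of_one_le h (by linarith : 1 ≤ r)]
  have hm : 0 ≤ ∫ x, Z x ∂μ := integral_nonneg_of_ae hZnonneg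
  set m := ∫ x, Z x ∂μ with hm_def
  have hlin : Integrable (fun ω => m ^ (r - 1) * (Z ω - m)) μ :=
    (hZ.sub (integrable_const m)).const_mul _
  calc ∫ ω, |Z ω - m| ^ r ∂μ
      ≤ ∫ ω, (Z ω ^ r - m ^ (r - 1) * (Z ω - m)) ∂μ := by
        refine integral_mono_of_nonneg (.of_forall fun ω => by positivity) (hint.sub hlin) ?_
        filter_upwards [hZnonneg] with ω hω
        exact abs_sub_rpow_le_rpow_sub_mul hω hm hr
    _ = ∫ ω, Z ω ^ r ∂μ := by
        rw [integral_sub hint hlin, integral_const_mul, integral_sub hZ (integrable_const m),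
          ← hm_def]
        simp
end

section
/- Suppose nℓ balls are arranged in an array of n rows and ℓ columns, and k balls with 2 ≤ k < n are chosen uniformly at random without replacement (i.e., a uniformly random k-element subset of the array is chosen). Let V_i be the number of chosen balls in row i and let ‖V‖₀ be the number of rows containing at least one chosen ball. Then P( ‖V‖₀ ≤ k − k²/(2n) − √(k·log k) ) ≤ 1/k². -/
open Finset
open scoped Classical

/-- Hoeffding's lemma for a Bernoulli variable of parameter `p`. -/
lemma bernoulli_mgf_le {p : ℝ} (hp0 : 0 ≤ p) (hp1 : p ≤ 1) (t : ℝ) :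
    1 + p * (Real.exp t - 1) ≤ Real.exp (p * t + t ^ 2 / 8) := by
  let μ : MeasureTheory.Measure ℝ :=
    ENNReal.ofReal p • MeasureTheory.Measure.dirac 1 +
      ENNReal.ofReal (1 - p) • MeasureTheory.Measure.dirac 0
  have hμ : MeasureTheory.IsProbabilityMeasure μ := by
    constructor
    simp [μ, ← ENNReal.ofReal_add hp0 (sub_nonneg.2 hp1)]
  have hint (f : ℝ → ℝ) : ∫ x, f x ∂μ = p * f 1 + (1 - p) * f 0 := by
    have hi (c a : ℝ) : MeasureTheory.Integrable f
        (ENNReal.ofReal c • MeasureTheory.Measure.dirac a) :=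
      (MeasureTheory.integrable_dirac (by simp)).smul_measure ENNReal.ofReal_ne_top
    rw [MeasureTheory.integral_add_measure (hi _ _) (hi _ _)]
    simp [MeasureTheory.integral_smul_measure, ENNReal.toReal_ofReal hp0,
      ENNReal.toReal_ofReal (sub_nonneg.2 hp1)]
  have hae : ∀ᵐ x ∂μ, x ∈ Set.Icc (0 : ℝ) 1 := by
    rw [MeasureTheory.ae_add_measure_iff]
    constructor <;>
    · refine MeasureTheory.Measure.ae_smul_measure ?_ _
      rw [MeasureTheory.ae_dirac_eq]
      simp
  have h := (ProbabilityTheory.hasSubgaussianMGF_of_mem_Icc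
    (X := fun x : ℝ => x) (by fun_prop) hae).mgf_le t
  rw [ProbabilityTheory.mgf, hint, hint] at h
  norm_num at h
  have h2 := mul_le_mul_of_nonneg_left h (Real.exp_pos (p * t)).le
  rw [← Real.exp_add] at h2
  have e1 : Real.exp (t * (1 - p)) = Real.exp t * Real.exp (-(t * p)) := by
    rw [← Real.exp_add]; ring_nf
  have e2 : Real.exp (p * t) * Real.exp (-(t * p)) = 1 := by
    rw [← Real.exp_add]; ring_nf; simp
  calc 1 + p * (Real.exp t - 1)
      = (Real.exp (p * t) * Real.exp (-(t * p))) * (1 + p * (Real.exp t - 1)) := by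
        rw [e2, one_mul]
    _ = Real.exp (p * t) *
          (p * Real.exp (t * (1 - p)) + (1 - p) * Real.exp (-(t * p))) := by
        rw [e1]; ring
    _ ≤ _ := h2
    _ = _ := by ring_nf

lemma sum_powersetCard_succ_mul {α : Type*} [Fintype α] [DecidableEq α] (j : ℕ)
    (f : Finset α → ℝ) :
    (j + 1 : ℝ) * ∑ s ∈ (univ : Finset α).powersetCard (j + 1), f s =
      ∑ s ∈ (univ : Finset α).powersetCard j, ∑ x ∈ sᶜ, f (insert x s) := by
  have h : (j + 1 : ℝ) * ∑ s ∈ (univ : Finset α).powersetCard (j + 1), f s =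
      ∑ s ∈ (univ : Finset α).powersetCard (j + 1), ∑ _x ∈ s, f s := by
    rw [mul_sum]
    refine sum_congr rfl fun s hs => ?_
    rw [sum_const, (mem_powersetCard.1 hs).2, nsmul_eq_mul]
    push_cast
    rfl
  rw [h, sum_sigma', sum_sigma']
  refine sum_bij' (fun a _ => ⟨a.1.erase a.2, a.2⟩) (fun a _ => ⟨insert a.2 a.1, a.2⟩)
    ?_ ?_ ?_ ?_ ?_
  · rintro ⟨s, x⟩ hs
    simp only [mem_sigma, mem_powersetCard_univ] at hs
    simp [card_erase_of_mem hs.2, hs.1]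
  · rintro ⟨s, x⟩ hs
    simp only [mem_sigma, mem_powersetCard_univ, mem_compl] at hs
    simp [card_insert_of_notMem hs.2, hs.1]
  · rintro ⟨s, x⟩ hs
    simp only [mem_sigma] at hs
    simp [insert_erase hs.2]
  · rintro ⟨s, x⟩ hs
    simp only [mem_sigma, mem_compl] at hs
    simp [erase_insert hs.2]
  · rintro ⟨s, x⟩ hs
    simp only [mem_sigma] at hs
    simp [insert_erase hs.2]

/-- The number of free positions lying in a row that `s` already meets. -/
lemma card_compl_filter_fst_mem_le {n l : ℕ} (s : Finset (Fin n × Fin l)) :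
    (#(sᶜ.filter fun x => x.1 ∈ s.image Prod.fst) : ℝ) ≤ #s * ((l : ℝ) - 1) := by
  have h : #(sᶜ.filter fun x => x.1 ∈ s.image Prod.fst) + #s ≤ #s * l := by
    rw [← card_union_of_disjoint
      ((disjoint_compl_left (a := s)).mono_left (filter_subset _ _))]
    calc _ ≤ #((s.image Prod.fst) ×ˢ (univ : Finset (Fin l))) := by
          refine card_le_card fun x hx => ?_
          rw [mem_product]
          refine ⟨?_, mem_univ _⟩
          rcases mem_union.1 hx with hx | hx
          · exact (mem_filter.1 hx).2
          · exact mem_image_of_mem _ hx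
      _ ≤ #s * l := by
          rw [card_product, card_univ, Fintype.card_fin]
          exact Nat.mul_le_mul_right _ card_image_le
  have h' : (#(sᶜ.filter fun x => x.1 ∈ s.image Prod.fst) : ℝ) + #s ≤ #s * l := by
    exact_mod_cast h
  linarith

lemma sum_compl_exp_collisions_le {n l : ℕ} {t : ℝ} (ht : 0 ≤ t) (s : Finset (Fin n × Fin l))
    (hs : #s < n) :
    ∑ x ∈ sᶜ, Real.exp (t * (#(insert x s) - #((insert x s).image Prod.fst))) ≤
      ((n : ℝ) * l - #s) * (1 + #s / n * (Real.exp t - 1)) *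
        Real.exp (t * (#s - #(s.image Prod.fst))) := by
  have hn : (0 : ℝ) < n := by exact_mod_cast (Nat.zero_le _).trans_lt hs
  have hsn : (#s : ℝ) ≤ n := by exact_mod_cast hs.le
  have hterm : ∀ x ∈ sᶜ, Real.exp (t * (#(insert x s) - #((insert x s).image Prod.fst))) =
      (1 + (if x.1 ∈ s.image Prod.fst then Real.exp t - 1 else 0)) *
        Real.exp (t * (#s - #(s.image Prod.fst))) := by
    intro x hx
    rw [card_insert_of_notMem (mem_compl.1 hx), image_insert]
    split_ifs with h
    · rw [insert_eq_of_mem h, add_sub_cancel, ← Real.exp_add]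
      push_cast
      ring_nf
    · rw [card_insert_of_notMem h]
      push_cast
      ring_nf
  rw [sum_congr rfl hterm, ← sum_mul]
  refine mul_le_mul_of_nonneg_right ?_ (Real.exp_pos _).le
  have hcard : (#sᶜ : ℝ) = n * l - #s := by
    rw [card_compl, Nat.cast_sub (card_le_univ s)]
    simp
  rw [sum_add_distrib, ← sum_filter, sum_const, sum_const, nsmul_eq_mul, nsmul_eq_mul, hcard,
    mul_one, mul_add, mul_one, ← mul_assoc]
  have he : 0 ≤ Real.exp t - 1 := by linarith [Real.one_le_exp ht]
  gcongr
  refine (card_compl_filter_fst_mem_le s).trans ?_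
  rw [← sub_nonneg]
  have : ((n : ℝ) * l - #s) * (#s / n) - #s * (l - 1) = #s * (n - #s) / n := by
    field_simp
    ring
  rw [this]
  exact div_nonneg (mul_nonneg (Nat.cast_nonneg _) (sub_nonneg.2 hsn)) hn.le

lemma sum_exp_collisions_le {n l j : ℕ} {t : ℝ} (ht : 0 ≤ t) (hl : 1 ≤ l) (hj : j ≤ n) :
    ∑ s ∈ (univ : Finset (Fin n × Fin l)).powersetCard j,
        Real.exp (t * (#s - #(s.image Prod.fst))) ≤
      (n * l).choose j * ∏ i ∈ range j, (1 + (i : ℝ) / n * (Real.exp t - 1)) := by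
  induction j with
  | zero => simp
  | succ j ih =>
    have hjl : j ≤ n * l := by nlinarith
    have hchoose : ((n * l).choose (j + 1) : ℝ) * (j + 1) =
        (n * l).choose j * ((n : ℝ) * l - j) := by
      have := Nat.choose_succ_right_eq (n * l) j
      have h := congrArg (Nat.cast : ℕ → ℝ) this
      rw [Nat.cast_mul, Nat.cast_mul, Nat.cast_sub hjl] at h
      push_cast at h
      exact h
    have he : 0 ≤ Real.exp t - 1 := by linarith [Real.one_le_exp ht]
    have hjl' : (0 : ℝ) ≤ (n : ℝ) * l - j := by
      rw [sub_nonneg]; exact_mod_cast hjl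
    have hpos : (0 : ℝ) < j + 1 := by positivity
    refine le_of_mul_le_mul_left ?_ hpos
    rw [sum_powersetCard_succ_mul]
    calc _ ≤ ∑ s ∈ (univ : Finset (Fin n × Fin l)).powersetCard j,
          ((n : ℝ) * l - j) * (1 + j / n * (Real.exp t - 1)) *
            Real.exp (t * (#s - #(s.image Prod.fst))) := by
          refine sum_le_sum fun s hs => ?_
          have hsj := (mem_powersetCard.1 hs).2
          have := sum_compl_exp_collisions_le ht s (by omega)
          rwa [hsj] at this ⊢
      _ ≤ ((n : ℝ) * l - j) * (1 + j / n * (Real.exp t - 1)) *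
          ((n * l).choose j * ∏ i ∈ range j, (1 + (i : ℝ) / n * (Real.exp t - 1))) := by
          rw [← mul_sum]
          exact mul_le_mul_of_nonneg_left (ih (by omega)) (by positivity)
      _ = _ := by
          rw [prod_range_succ]
          linear_combination (-(∏ i ∈ range j, (1 + (i : ℝ) / n * (Real.exp t - 1))) *
            (1 + j / n * (Real.exp t - 1))) * hchoose

lemma prod_one_add_le_exp {n k : ℕ} (hkn : k ≤ n) {t : ℝ} (ht : 0 ≤ t) :
    ∏ i ∈ range k, (1 + (i : ℝ) / n * (Real.exp t - 1)) ≤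
      Real.exp (t * (k ^ 2 / (2 * n)) + k * (t ^ 2 / 8)) := by
  have he : 0 ≤ Real.exp t - 1 := by linarith [Real.one_le_exp ht]
  calc _ ≤ ∏ i ∈ range k, Real.exp ((i : ℝ) / n * t + t ^ 2 / 8) := by
        refine prod_le_prod (fun i _ => by positivity) fun i hi => ?_
        refine bernoulli_mgf_le (by positivity) (div_le_one_of_le₀ ?_ (by positivity)) t
        exact_mod_cast ((mem_range.1 hi).le.trans hkn)
    _ ≤ _ := by
        rw [← Real.exp_sum, Real.exp_le_exp, sum_add_distrib, ← sum_mul, ← sum_div, sum_const,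
          card_range, nsmul_eq_mul, mul_comm t]
        have hsum : ∑ i ∈ range k, (i : ℝ) ≤ k ^ 2 / 2 := by
          have := Finset.sum_range_id_mul_two k
          have h2 : (∑ i ∈ range k, i) * 2 ≤ k ^ 2 := by
            rw [this, sq]; exact Nat.mul_le_mul_left _ (Nat.sub_le _ _)
          have h3 := (Nat.cast_le (α := ℝ)).2 h2
          push_cast at h3
          linarith
        rw [← div_div]
        gcongr

theorem stmt_16 (n l k : ℕ) (hl : 1 ≤ l) (hk : 2 ≤ k) (hkn : k < n) :
    ((((Finset.univ : Finset (Fin n × Fin l)).powersetCard k).filter fun s =>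
          (((s.image Prod.fst).card : ℝ)) ≤
            k - k ^ 2 / (2 * n) - Real.sqrt (k * Real.log k)).card : ℝ) /
        ((n * l).choose k : ℝ) ≤ 1 / k ^ 2 := by
  have hk0 : (0 : ℝ) < k := by positivity
  have hlog : 0 ≤ Real.log k := Real.log_natCast_nonneg k
  set r := Real.sqrt (k * Real.log k)
  have hr2 : r ^ 2 = k * Real.log k := Real.sq_sqrt (by positivity)
  have hr0 : 0 ≤ r := Real.sqrt_nonneg _
  set t := 4 * r / k with htdef
  have ht : 0 ≤ t := by positivity
  have hC : (0 : ℝ) < (n * l).choose k := by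
    exact_mod_cast Nat.choose_pos (by nlinarith)
  rw [div_le_iff₀ hC]
  set F := ((Finset.univ : Finset (Fin n × Fin l)).powersetCard k).filter fun s =>
    (((s.image Prod.fst).card : ℝ)) ≤ k - k ^ 2 / (2 * n) - r
  have hmarkov : (#F : ℝ) * Real.exp (t * (k ^ 2 / (2 * n) + r)) ≤
      (n * l).choose k * Real.exp (t * (k ^ 2 / (2 * n)) + k * (t ^ 2 / 8)) :=
    calc (#F : ℝ) * Real.exp (t * (k ^ 2 / (2 * n) + r))
        = ∑ _s ∈ F, Real.exp (t * (k ^ 2 / (2 * n) + r)) := by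
          rw [sum_const, nsmul_eq_mul]
      _ ≤ ∑ s ∈ F, Real.exp (t * (#s - #(s.image Prod.fst))) := by
          refine sum_le_sum fun s hs => Real.exp_le_exp.2 (mul_le_mul_of_nonneg_left ?_ ht)
          obtain ⟨h1, h2⟩ := mem_filter.1 hs
          rw [(mem_powersetCard.1 h1).2]
          linarith
      _ ≤ ∑ s ∈ (univ : Finset (Fin n × Fin l)).powersetCard k,
            Real.exp (t * (#s - #(s.image Prod.fst))) :=
          sum_le_sum_of_subset_of_nonneg (filter_subset _ _) fun _ _ _ => (Real.exp_pos _).le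
      _ ≤ _ := (sum_exp_collisions_le ht hl hkn.le).trans
          (mul_le_mul_of_nonneg_left (prod_one_add_le_exp hkn.le ht) hC.le)
  have hexp : Real.exp (t * (k ^ 2 / (2 * n)) + k * (t ^ 2 / 8)) =
      1 / k ^ 2 * Real.exp (t * (k ^ 2 / (2 * n) + r)) := by
    have h1 : (1 : ℝ) / k ^ 2 = Real.exp (-(2 * Real.log k)) := by
      rw [Real.exp_neg, two_mul, Real.exp_add, Real.exp_log hk0, one_div, sq]
    have htr : t * r = 4 * Real.log k := by
      rw [htdef, div_mul_eq_mul_div, mul_assoc, ← sq, hr2]; field_simp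
    have ht2 : k * (t ^ 2 / 8) = 2 * Real.log k := by
      rw [htdef, div_pow, mul_pow, hr2]; field_simp; ring
    rw [h1, ← Real.exp_add, mul_add, htr, ht2]
    ring_nf
  rw [hexp] at hmarkov
  refine le_of_mul_le_mul_right (hmarkov.trans_eq ?_) (Real.exp_pos (t * (k ^ 2 / (2 * n) + r)))
  ring
end

section
/- Suppose nℓ balls are arranged in an array of n rows and ℓ columns, and k balls with 1 ≤ k < n are chosen uniformly at random without replacement (a uniformly random k-element subset of the array). Let V_i be the number of chosen balls in row i. If k ≤ n^γ for some γ ∈ (0,1) and n ≥ 2, then for every positive integer a, P( max_i V_i ≥ a ) ≤ n^{1−a(1−γ)} / (1 − n^{−(1−γ)}). -/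
open Finset
open scoped Classical

/-- At most `(|α| - |t|).choose (k - |t|)` of the `k`-element subsets of `α` contain a fixed
set `t`. -/
theorem card_powersetCard_superset_le {α : Type*} [Fintype α] (t : Finset α) (k : ℕ) :
    (((univ : Finset α).powersetCard k).filter fun s => t ⊆ s).card ≤
      (Fintype.card α - t.card).choose (k - t.card) := by
  rw [← card_compl, ← card_powersetCard]
  refine card_le_card_of_injOn (fun s => s \ t) ?_ ?_
  · intro s hs
    simp only [coe_filter, mem_powersetCard, Set.mem_ofPred_eq] at hs
    simp only [mem_coe, mem_powersetCard]
    refine ⟨fun x hx => ?_, ?_⟩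
    · simp only [mem_sdiff] at hx
      simpa using hx.2
    · rw [card_sdiff_of_subset hs.2, hs.1.2]
  · intro s hs u hu h
    simp only [coe_filter, mem_powersetCard, Set.mem_ofPred_eq] at hs hu
    rw [← sdiff_union_of_subset hs.2, ← sdiff_union_of_subset hu.2]
    exact congrArg (· ∪ t) h

theorem pow_mul_descFactorial_le (n l a : ℕ) (hn : 1 ≤ n) :
    n ^ a * l.descFactorial a ≤ (n * l).descFactorial a := by
  induction a with
  | zero => simp
  | succ a ih =>
    rw [Nat.descFactorial_succ, Nat.descFactorial_succ, pow_succ]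
    have h : n * (l - a) ≤ n * l - a := by
      rw [Nat.mul_sub]
      exact Nat.sub_le_sub_left (Nat.le_mul_of_pos_left a hn) _
    calc n ^ a * n * ((l - a) * l.descFactorial a)
        = (n * (l - a)) * (n ^ a * l.descFactorial a) := by ring
      _ ≤ _ := Nat.mul_le_mul h ih

theorem pow_mul_choose_le (n l a : ℕ) (hn : 1 ≤ n) :
    n ^ a * l.choose a ≤ (n * l).choose a := by
  refine Nat.le_of_mul_le_mul_left ?_ a.factorial_pos
  rw [← Nat.descFactorial_eq_factorial_mul_choose, mul_left_comm,
    ← Nat.descFactorial_eq_factorial_mul_choose]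
  exact pow_mul_descFactorial_le n l a hn

theorem card_exists_row_le (n l k a : ℕ) :
    (((Finset.univ : Finset (Fin n × Fin l)).powersetCard k).filter fun s =>
        ∃ i : Fin n, a ≤ (s.filter fun b => b.1 = i).card).card ≤
      n * (l.choose a * (n * l - a).choose (k - a)) := by
  let row : Fin n → Finset (Fin n × Fin l) := fun i => {i} ×ˢ univ
  calc _ ≤ (univ.biUnion fun i : Fin n => ((row i).powersetCard a).biUnion fun t =>
        ((univ : Finset (Fin n × Fin l)).powersetCard k).filter fun s => t ⊆ s).card := by
        refine card_le_card fun s hs => ?_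
        obtain ⟨hs, i, hi⟩ := mem_filter.1 hs
        obtain ⟨t, ht, hta⟩ := exists_subset_card_eq hi
        simp only [mem_biUnion, mem_univ, true_and, mem_filter]
        refine ⟨i, t, mem_powersetCard.2 ⟨fun x hx => ?_, hta⟩, hs,
          ht.trans (filter_subset _ _)⟩
        exact mem_product.2 ⟨mem_singleton.2 (mem_filter.1 (ht hx)).2, mem_univ _⟩
    _ ≤ (univ : Finset (Fin n)).card * (l.choose a * (n * l - a).choose (k - a)) := by
        refine card_biUnion_le_card_mul _ _ _ fun i _ => ?_
        have hrow : ((row i).powersetCard a).card = l.choose a := by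
          simp [row, card_powersetCard]
        rw [← hrow]
        refine card_biUnion_le_card_mul _ _ _ fun t ht => ?_
        have h := card_powersetCard_superset_le t k
        rw [(mem_powersetCard.1 ht).2, Fintype.card_prod, Fintype.card_fin,
          Fintype.card_fin] at h
        convert h
    _ = _ := by rw [card_fin]

theorem card_exists_row_mul_pow_le (n l k a : ℕ) (hn : 1 ≤ n) :
    (((Finset.univ : Finset (Fin n × Fin l)).powersetCard k).filter fun s =>
        ∃ i : Fin n, a ≤ (s.filter fun b => b.1 = i).card).card * n ^ a ≤
      n * k ^ a * (n * l).choose k := by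
  rcases lt_or_ge k a with hka | hak
  · rw [filter_false_of_mem]
    · simp
    · rintro s hs ⟨i, hi⟩
      have := card_filter_le s fun b => b.1 = i
      have := (mem_powersetCard.1 hs).2
      omega
  rcases lt_or_ge (n * l) k with hlk | hkl
  · rw [powersetCard_eq_empty.2 (by simpa using hlk)]
    simp
  calc _ ≤ n * (l.choose a * (n * l - a).choose (k - a)) * n ^ a :=
        Nat.mul_le_mul_right _ (card_exists_row_le n l k a)
    _ = n * (n ^ a * l.choose a) * (n * l - a).choose (k - a) := by ring
    _ ≤ n * (n * l).choose a * (n * l - a).choose (k - a) := by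
        gcongr
        exact pow_mul_choose_le n l a hn
    _ = n * k.choose a * (n * l).choose k := by
        rw [mul_assoc, ← Nat.choose_mul hak]
        ring
    _ ≤ _ := by
        gcongr
        exact Nat.choose_le_pow k a

theorem stmt_17 (n l k : ℕ) (hk : 1 ≤ k) (hkn : k < n) (hn : 2 ≤ n)
    (γ : ℝ) (hγ0 : 0 < γ) (hγ1 : γ < 1) (hkγ : (k : ℝ) ≤ (n : ℝ) ^ γ)
    (a : ℕ) (ha : 1 ≤ a) :
    ((((Finset.univ : Finset (Fin n × Fin l)).powersetCard k).filter fun s =>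
          ∃ i : Fin n, a ≤ (s.filter fun b => b.1 = i).card).card : ℝ) /
        ((n * l).choose k : ℝ) ≤
      (n : ℝ) ^ ((1 : ℝ) - a * (1 - γ)) / (1 - (n : ℝ) ^ (-(1 - γ))) := by
  have hn1 : (1 : ℝ) < n := by exact_mod_cast hn
  have hn0 : (0 : ℝ) < n := by linarith
  have hlt : (n : ℝ) ^ (-(1 - γ)) < 1 := Real.rpow_lt_one_of_one_lt_of_neg hn1 (by linarith)
  have hpos : 0 < (n : ℝ) ^ (-(1 - γ)) := by positivity
  have hbound : (n : ℝ) * k ^ a ≤ n ^ ((1 : ℝ) - a * (1 - γ)) * n ^ a := by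
    calc (n : ℝ) * k ^ a ≤ n * ((n : ℝ) ^ γ) ^ a := by gcongr
      _ = (n : ℝ) ^ (1 + γ * a) := by
        rw [Real.rpow_add hn0, Real.rpow_one, Real.rpow_mul_natCast hn0.le]
      _ = _ := by
        rw [← Real.rpow_natCast (n : ℝ) a, ← Real.rpow_add hn0]
        ring_nf
  refine le_trans ?_ (le_div_self (by positivity) (by linarith) (by linarith))
  refine div_le_of_le_mul₀ (by positivity) (by positivity) ?_
  refine le_of_mul_le_mul_right ?_ (pow_pos hn0 a)
  calc _ ≤ (n : ℝ) * k ^ a * ((n * l).choose k : ℝ) := by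
        exact_mod_cast card_exists_row_mul_pow_le n l k a (by omega)
    _ ≤ n ^ ((1 : ℝ) - a * (1 - γ)) * n ^ a * ((n * l).choose k : ℝ) := by gcongr
    _ = _ := by ring
end
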